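/- Let G be a finite simple connected graph with nonempty sink Z, and let the initial rotor configuration ρ be sampled uniformly at random from the Z-oriented spanning forests of G. Then for every vertex x, the expected number of visits to x by the rotor walk started at a (before hitting Z) equals the Green function G(a,x) of the simple random walk. -/

import Mathlib

open MeasureTheory Filter ENNReal Set

namespace RotorWalk

variable {V : Type*} [DecidableEq V]

/-- One step of the rotor walk with local mechanisms `τ`:
the rotor at the current position is advanced and the walker follows it. -/
def step (τ : V → V → V) (p : V × (V → V)) : V × (V → V) :=
  (τ p.1 (p.2 p.1), Function.update p.2 p.1 (τ p.1 (p.2 p.1)))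

/-- Trajectory (position, rotor configuration) of the rotor walk started at `a`
with initial rotor configuration `ρ`. -/
def traj (τ : V → V → V) (a : V) (ρ : V → V) : ℕ → V × (V → V)
  | 0 => (a, ρ)
  | t + 1 => step τ (traj τ a ρ t)

/-- Position of the walker at time `t`. -/
def pos (τ : V → V → V) (a : V) (ρ : V → V) (t : ℕ) : V := (traj τ a ρ t).1

/-- Rotor configuration at time `t`. -/
def conf (τ : V → V → V) (a : V) (ρ : V → V) (t : ℕ) : V → V := (traj τ a ρ t).2

/-- The walk has not hit the sink `Z` up to and including time `t`. -/
def aliveAt (τ : V → V → V) (Z : Set V) (a : V) (ρ : V → V) (t : ℕ) : Prop :=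
  ∀ s ≤ t, pos τ a ρ s ∉ Z

/-- Odometer: the number of visits to `x` strictly before hitting the sink `Z`. -/
noncomputable def odometer (τ : V → V → V) (Z : Set V) (a : V) (ρ : V → V) (x : V) : ℕ∞ :=
  {t : ℕ | aliveAt τ Z a ρ t ∧ pos τ a ρ t = x}.encard

/-- Number of traversals of the directed edge `(y, x)` strictly before hitting `Z`. -/
noncomputable def edgeCount (τ : V → V → V) (Z : Set V) (a : V) (ρ : V → V) (y x : V) : ℕ∞ :=
  {t : ℕ | aliveAt τ Z a ρ t ∧ pos τ a ρ t = y ∧ pos τ a ρ (t + 1) = x}.encard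

open Classical in
/-- The final rotor configuration: the configuration at the hitting time of `Z` if the walk
hits `Z`, and otherwise the pointwise eventual value of the rotor configuration
(which exists when the walk is transient). -/
noncomputable def finalConf (τ : V → V → V) (Z : Set V) (a : V) (ρ : V → V) : V → V :=
  if ∃ t, pos τ a ρ t ∈ Z then conf τ a ρ (sInf {t | pos τ a ρ t ∈ Z})
  else fun x => if h : ∃ v, ∀ᶠ t in atTop, conf τ a ρ t x = v then h.choose else ρ x

/-- Total number of visits to `x` by `n` sequential rotor walks (rotors not reset). -/
noncomputable def Svis (τ : V → V → V) (Z : Set V) (a : V) (ρ : V → V) (n : ℕ) (x : V) : ℕ∞ :=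
  ∑ i ∈ Finset.range n, odometer τ Z a ((finalConf τ Z a)^[i] ρ) x

/-- Total number of traversals of the directed edge `(y,x)` by `n` sequential rotor walks. -/
noncomputable def Sedge (τ : V → V → V) (Z : Set V) (a : V) (ρ : V → V) (n : ℕ) (y x : V) : ℕ∞ :=
  ∑ i ∈ Finset.range n, edgeCount τ Z a ((finalConf τ Z a)^[i] ρ) y x

/-- The rotor walk is transient: every vertex is visited finitely often (before hitting `Z`). -/
def IsTransientWalk (τ : V → V → V) (Z : Set V) (a : V) (ρ : V → V) : Prop :=
  ∀ x : V, {t : ℕ | aliveAt τ Z a ρ t ∧ pos τ a ρ t = x}.Finite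

open Classical in
/-- Total number of visits to `x` by `n` sequential rotor walks with empty sink,
set to `⊤` if one of the `n` walks fails to be transient. -/
noncomputable def SvisT (τ : V → V → V) (a : V) (ρ : V → V) (n : ℕ) (x : V) : ℕ∞ :=
  if ∀ i < n, IsTransientWalk τ ∅ a ((finalConf τ ∅ a)^[i] ρ) then Svis τ ∅ a ρ n x else ⊤

/-- The local mechanisms map neighbors to neighbors and have a single orbit on each
neighborhood (off the sink). -/
def ValidMechanism (G : SimpleGraph V) (Z : Set V) (τ : V → V → V) : Prop :=
  ∀ x ∉ Z, (∀ y, G.Adj x y → G.Adj x (τ x y)) ∧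
    ∀ y, G.Adj x y → ∀ z, G.Adj x z → ∃ i : ℕ, (τ x)^[i] y = z

/-- A rotor configuration: every rotor (off the sink) points to a neighbor. -/
def ValidConfig (G : SimpleGraph V) (Z : Set V) (ρ : V → V) : Prop :=
  ∀ x ∉ Z, G.Adj x (ρ x)

/-- Time-`t` distribution of the simple random walk started at `a` and killed on `Z`. -/
noncomputable def srw (G : SimpleGraph V) [G.LocallyFinite] (Z : Set V) (a : V) :
    ℕ → V → ℝ≥0∞
  | 0 => Set.indicator {a} 1
  | t + 1 => fun x =>
      ∑' y : V, Set.indicator {y | G.Adj y x ∧ y ∉ Z}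
        (fun y => srw G Z a t y / (G.degree y : ℝ≥0∞)) y

/-- Green function: the expected number of visits to a vertex, strictly before hitting `Z`,
of the simple random walk started at `a`. -/
noncomputable def green (G : SimpleGraph V) [G.LocallyFinite] (Z : Set V) (a : V) : V → ℝ≥0∞ :=
  Set.indicator Zᶜ (fun x => ∑' t : ℕ, srw G Z a t x)

/-- The graph is transient: the Green function (with empty sink) is finite. -/
def TransientGraph (G : SimpleGraph V) [G.LocallyFinite] : Prop :=
  ∀ a x : V, green G ∅ a x < ⊤

/-- A `Z`-oriented spanning forest, encoded as a rotor configuration: off `Z` it points to a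
neighbor, on `Z` it is normalized to the identity, and every vertex eventually reaches `Z`. -/
def IsOSF (G : SimpleGraph V) (Z : Set V) (ρ : V → V) : Prop :=
  (∀ x ∉ Z, G.Adj x (ρ x)) ∧ (∀ x ∈ Z, ρ x = x) ∧ ∀ x : V, ∃ n : ℕ, ρ^[n] x ∈ Z

/-- An oriented spanning forest of an infinite graph: every vertex has out-degree one along
an edge and there is no directed cycle. -/
def IsOSFInf (G : SimpleGraph V) (ρ : V → V) : Prop :=
  (∀ x, G.Adj x (ρ x)) ∧ ∀ x : V, ∀ n > 0, ρ^[n] x ≠ x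

/-- A spanning forest of the ball of radius `R` around `a`, oriented toward the boundary
sphere (the sink), normalized to the identity outside the open ball. -/
def IsOSFBall (G : SimpleGraph V) (a : V) (R : ℕ) (ρ : V → V) : Prop :=
  (∀ x, G.dist a x < R → G.Adj x (ρ x)) ∧
  (∀ x, ¬ G.dist a x < R → ρ x = x) ∧
  ∀ x, G.dist a x < R → ∃ n : ℕ, G.dist a (ρ^[n] x) = R

instance : MeasurableSpace (V → V) := ⊤

/-- `μ` is the oriented wired uniform spanning forest measure of `G` (with respect to the
exhaustion by balls around `a`): it is a probability measure supported on oriented spanning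
forests whose finite-dimensional marginals are the limits of the uniform measures on
boundary-oriented spanning forests of the balls. -/
def IsOWUSF (G : SimpleGraph V) (a : V) (μ : Measure (V → V)) : Prop :=
  IsProbabilityMeasure μ ∧
  (∀ᵐ ρ ∂μ, IsOSFInf G ρ) ∧
  ∀ B : Finset (V × V),
    Tendsto (fun R : ℕ =>
        (({ρ : V → V | IsOSFBall G a R ρ ∧ ∀ e ∈ B, ρ e.1 = e.2}.ncard : ℝ) /
          ({ρ : V → V | IsOSFBall G a R ρ}.ncard : ℝ))) atTop
      (nhds ((μ {ρ : V → V | ∀ e ∈ B, ρ e.1 = e.2}).toReal))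

/-- Vertex-transitivity. -/
def VertexTransitive (G : SimpleGraph V) : Prop :=
  ∀ u v : V, ∃ φ : G ≃g G, φ u = v

/-- `μ` is stationary for the rotor walk (empty sink) started at `a`: almost every walk is
transient and the final rotor configuration again has law `μ`. -/
def RWStationary (τ : V → V → V) (a : V) (μ : Measure (V → V)) : Prop :=
  (∀ᵐ ρ ∂μ, IsTransientWalk τ ∅ a ρ) ∧ μ.map (finalConf τ ∅ a) = μ

section Aux

set_option linter.unusedSectionVars false

/-! ### Abstract reachability lemmas -/

lemma reach_same {W : Type*} {F F' : W → W} {w : W} (h : ∀ v, v ≠ w → F' v = F v) :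
    ∀ (n : ℕ) (v : W), F^[n] v = w → ∃ m, F'^[m] v = w := by
  intro n
  induction n with
  | zero => intro v hv; exact ⟨0, hv⟩
  | succ n ih =>
    intro v hv
    by_cases hvw : v = w
    · exact ⟨0, hvw⟩
    · obtain ⟨m, hm⟩ := ih (F v) hv
      refine ⟨m + 1, ?_⟩
      rw [Function.iterate_succ_apply, h v hvw, hm]

lemma eq_of_common_image {W : Type*} {F : W → W} {w w₁ w₂ : W} (h₁ : F w₁ = w) (h₂ : F w₂ = w)
    (r₁ : ∃ p, F^[p] w = w₁) (r₂ : ∃ p, F^[p] w = w₂) : w₁ = w₂ := by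
  obtain ⟨p, hp⟩ := r₁
  obtain ⟨q, hq⟩ := r₂
  have hp' : Function.IsPeriodicPt F (p + 1) w := by
    unfold Function.IsPeriodicPt Function.IsFixedPt
    rw [Function.iterate_succ_apply', hp, h₁]
  have hq' : Function.IsPeriodicPt F (q + 1) w := by
    unfold Function.IsPeriodicPt Function.IsFixedPt
    rw [Function.iterate_succ_apply', hq, h₂]
  have e1 : F^[p + (p + 1) * q] w = w₁ := by
    rw [Function.iterate_add_apply, (hp'.mul_const q : _), hp]
  have e2 : F^[q + (q + 1) * p] w = w₂ := by
    rw [Function.iterate_add_apply, (hq'.mul_const p : _), hq]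
  have e3 : p + (p + 1) * q = q + (q + 1) * p := by ring
  rw [← e1, ← e2, e3]

/-! ### The unicycle dynamics -/

variable {V : Type*} [DecidableEq V]

open Classical in
/-- Collapse the sink to the single vertex `z`. -/
noncomputable def col (Z : Set V) (z : V) (v : V) : V := if v ∈ Z then z else v

open Classical in
/-- Functional graph of a rotor configuration, with the sink pointing to `a`. -/
noncomputable def fg (Z : Set V) (z a : V) (ρ : V → V) (v : V) : V :=
  if v ∈ Z then a else col Z z (ρ v)

open Classical in
/-- One step of the recurrent dynamics. -/
noncomputable def bigStep (τ : V → V → V) (Z : Set V) (z a : V) (p : V × (V → V)) :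
    V × (V → V) :=
  if p.1 ∈ Z then (a, p.2) else (col Z z (step τ p).1, (step τ p).2)

/-- Unicycle states. -/
def uni (G : SimpleGraph V) (Z : Set V) (z a : V) : Set (V × (V → V)) :=
  {p | (p.1 ∈ Z → p.1 = z) ∧ (∀ x ∉ Z, G.Adj x (p.2 x)) ∧ (∀ x ∈ Z, p.2 x = x) ∧
    ∀ v, ∃ n : ℕ, (fg Z z a p.2)^[n] v = p.1}

lemma mech_inj [Finite V] {G : SimpleGraph V} {Z : Set V} {τ : V → V → V}
    (hτ : ValidMechanism G Z τ) {x : V} (hx : x ∉ Z) {u v : V} (hu : G.Adj x u)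
    (hv : G.Adj x v) (h : τ x u = τ x v) : u = v := by
  obtain ⟨h1, h2⟩ := hτ x hx
  let f : G.neighborSet x → G.neighborSet x := fun y => ⟨τ x y, h1 y y.2⟩
  have hs : Function.Surjective f := by
    rintro ⟨y, hy⟩
    obtain ⟨i, hi⟩ := h2 (τ x y) (h1 y hy) y hy
    have hadj : ∀ j, G.Adj x ((τ x)^[j] y) := by
      intro j
      induction j with
      | zero => exact hy
      | succ j ih => rw [Function.iterate_succ_apply']; exact h1 _ ih
    refine ⟨⟨(τ x)^[i] y, hadj i⟩, Subtype.ext ?_⟩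
    show τ x ((τ x)^[i] y) = y
    rw [← Function.iterate_succ_apply' (τ x) i y, Function.iterate_succ_apply, hi]
  have hi := Finite.injective_iff_surjective.2 hs
  have := @hi ⟨u, hu⟩ ⟨v, hv⟩ (Subtype.ext h)
  exact congrArg Subtype.val this

lemma col_mem {Z : Set V} {z : V} {v : V} : col Z z v ∈ Z → col Z z v = z := by
  unfold col; split_ifs with h <;> simp_all

lemma fg_big {τ : V → V → V} {Z : Set V} {z a : V} {p : V × (V → V)} :
    fg Z z a (bigStep τ Z z a p).2 p.1 = (bigStep τ Z z a p).1 := by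
  unfold bigStep fg
  split_ifs with h
  · rfl
  · simp [step]

lemma fg_big_ne {τ : V → V → V} {Z : Set V} {z a : V} {p : V × (V → V)} {v : V} (hv : v ≠ p.1) :
    fg Z z a (bigStep τ Z z a p).2 v = fg Z z a p.2 v := by
  unfold bigStep fg
  split_ifs with h h'
  · rfl
  · rfl
  · simp [step, hv]

lemma big_reach {G : SimpleGraph V} {τ : V → V → V} {Z : Set V} {z a : V} {p : V × (V → V)}
    (hp : p ∈ uni G Z z a) (v : V) : ∃ n : ℕ, (fg Z z a (bigStep τ Z z a p).2)^[n] v = p.1 := by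
  obtain ⟨n, hn⟩ := hp.2.2.2 v
  exact reach_same (fun v hv => fg_big_ne hv) n v hn

lemma big_maps {G : SimpleGraph V} {τ : V → V → V} {Z : Set V} {z a : V}
    (hτ : ValidMechanism G Z τ) (ha : a ∉ Z) {p : V × (V → V)}
    (hp : p ∈ uni G Z z a) : bigStep τ Z z a p ∈ uni G Z z a := by
  refine ⟨?_, ?_, ?_, ?_⟩
  · unfold bigStep
    split_ifs with h
    · intro h'; exact absurd h' ha
    · exact col_mem
  · intro x hx
    unfold bigStep
    split_ifs with h
    · exact hp.2.1 x hx
    · by_cases hxp : x = p.1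
      · subst hxp
        simpa [step] using (hτ _ hx).1 _ (hp.2.1 _ hx)
      · simpa [step, hxp] using hp.2.1 x hx
  · intro x hx
    unfold bigStep
    split_ifs with h
    · exact hp.2.2.1 x hx
    · have hxp : x ≠ p.1 := fun e => h (e ▸ hx)
      simpa [step, hxp] using hp.2.2.1 x hx
  · intro v
    obtain ⟨n, hn⟩ := big_reach (τ := τ) hp v
    exact ⟨n + 1, by rw [Function.iterate_succ_apply', hn, fg_big]⟩

lemma big_inj [Finite V] {G : SimpleGraph V} {τ : V → V → V} {Z : Set V} {z a : V}
    (hτ : ValidMechanism G Z τ) {p q : V × (V → V)}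
    (hp : p ∈ uni G Z z a) (hq : q ∈ uni G Z z a)
    (h : bigStep τ Z z a p = bigStep τ Z z a q) : p = q := by
  have h1 : p.1 = q.1 := by
    apply eq_of_common_image (F := fg Z z a (bigStep τ Z z a p).2) (w := (bigStep τ Z z a p).1)
    · exact fg_big
    · rw [h]; exact fg_big
    · exact big_reach hp _
    · rw [h]; exact big_reach hq _
  obtain ⟨w, ρ⟩ := p
  obtain ⟨w', ρ'⟩ := q
  simp only at h1
  subst h1
  refine Prod.ext rfl ?_
  unfold bigStep at h
  split_ifs at h with hw
  · simpa using h
  · have h2 : Function.update ρ w (τ w (ρ w)) = Function.update ρ' w (τ w (ρ' w)) :=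
      congrArg Prod.snd h
    funext x
    by_cases hx : x = w
    · subst hx
      have := congrFun h2 x
      simp only [Function.update_self] at this
      exact mech_inj hτ hw (hp.2.1 _ hw) (hq.2.1 _ hw) this
    · have := congrFun h2 x
      simpa [hx] using this

lemma iter_maps {G : SimpleGraph V} {τ : V → V → V} {Z : Set V} {z a : V}
    (hτ : ValidMechanism G Z τ) (ha : a ∉ Z) {p : V × (V → V)}
    (hp : p ∈ uni G Z z a) (n : ℕ) : (bigStep τ Z z a)^[n] p ∈ uni G Z z a := by
  induction n with
  | zero => exact hp
  | succ n ih => rw [Function.iterate_succ_apply']; exact big_maps hτ ha ih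

lemma iter_inj [Finite V] {G : SimpleGraph V} {τ : V → V → V} {Z : Set V} {z a : V}
    (hτ : ValidMechanism G Z τ) (ha : a ∉ Z) {p q : V × (V → V)}
    (hp : p ∈ uni G Z z a) (hq : q ∈ uni G Z z a) (n : ℕ)
    (h : (bigStep τ Z z a)^[n] p = (bigStep τ Z z a)^[n] q) : p = q := by
  induction n with
  | zero => exact h
  | succ n ih =>
    rw [Function.iterate_succ_apply', Function.iterate_succ_apply'] at h
    exact ih (big_inj hτ (iter_maps hτ ha hp n) (iter_maps hτ ha hq n) h)

lemma big_periodic [Finite V] {G : SimpleGraph V} {τ : V → V → V} {Z : Set V} {z a : V}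
    (hτ : ValidMechanism G Z τ) (ha : a ∉ Z) {p : V × (V → V)}
    (hp : p ∈ uni G Z z a) : ∃ n : ℕ, (bigStep τ Z z a)^[n + 1] p = p := by
  obtain ⟨m, n, hmn, he⟩ :=
    Finite.exists_ne_map_eq_of_infinite (fun n : ℕ => (bigStep τ Z z a)^[n] p)
  wlog hlt : m < n generalizing m n
  · exact this n m hmn.symm he.symm (by omega)
  obtain ⟨k, rfl⟩ : ∃ k, n = m + (k + 1) := ⟨n - m - 1, by omega⟩
  refine ⟨k, ?_⟩
  beta_reduce at he
  rw [Function.iterate_add_apply] at he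
  exact (iter_inj hτ ha hp (iter_maps hτ ha hp (k + 1)) m he).symm

lemma osf_iff {G : SimpleGraph V} {Z : Set V} {z a : V} (hz : z ∈ Z) (ha : a ∉ Z) (ρ : V → V) :
    (z, ρ) ∈ uni G Z z a ↔ IsOSF G Z ρ := by
  constructor
  · rintro ⟨-, h1, h2, h3⟩
    refine ⟨h1, h2, ?_⟩
    have key : ∀ (n : ℕ) (v : V), (fg Z z a ρ)^[n] v = z → ∃ m, ρ^[m] v ∈ Z := by
      intro n
      induction n with
      | zero => intro v hv; exact ⟨0, by simpa using (show v = z from hv) ▸ hz⟩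
      | succ n ih =>
        intro v hv
        by_cases hvZ : v ∈ Z
        · exact ⟨0, hvZ⟩
        by_cases hρ : ρ v ∈ Z
        · exact ⟨1, hρ⟩
        rw [Function.iterate_succ_apply] at hv
        have : fg Z z a ρ v = ρ v := by simp [fg, col, hvZ, hρ]
        rw [this] at hv
        obtain ⟨m, hm⟩ := ih _ hv
        exact ⟨m + 1, hm⟩
    intro v
    obtain ⟨n, hn⟩ := h3 v
    exact key n v hn
  · rintro ⟨h1, h2, h3⟩
    refine ⟨fun _ => rfl, h1, h2, ?_⟩
    have key : ∀ (n : ℕ) (v : V), v ∉ Z → ρ^[n] v ∈ Z → ∃ m, (fg Z z a ρ)^[m] v = z := by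
      intro n
      induction n with
      | zero => intro v hv hv'; exact absurd hv' hv
      | succ n ih =>
        intro v hvZ hv
        by_cases hρ : ρ v ∈ Z
        · exact ⟨1, by simp [fg, col, hvZ, hρ]⟩
        · obtain ⟨m, hm⟩ := ih (ρ v) hρ hv
          have : fg Z z a ρ v = ρ v := by simp [fg, col, hvZ, hρ]
          exact ⟨m + 1, by rw [Function.iterate_succ_apply, this, hm]⟩
    have key2 : ∀ v, v ∉ Z → ∃ m, (fg Z z a ρ)^[m] v = z := by
      intro v hv
      obtain ⟨n, hn⟩ := h3 v
      exact key n v hv hn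
    intro v
    by_cases hv : v ∈ Z
    · obtain ⟨m, hm⟩ := key2 a ha
      have : fg Z z a ρ v = a := by simp [fg, hv]
      exact ⟨m + 1, by rw [Function.iterate_succ_apply, this, hm]⟩
    · exact key2 v hv

/-! ### The rotor walk from a forest -/

lemma pos_succ (τ : V → V → V) (a : V) (ρ : V → V) (t : ℕ) :
    pos τ a ρ (t + 1) = conf τ a ρ (t + 1) (pos τ a ρ t) := by
  simp [pos, conf, traj, step]

lemma conf_succ_self (τ : V → V → V) (a : V) (ρ : V → V) (t : ℕ) :
    conf τ a ρ (t + 1) (pos τ a ρ t) = τ (pos τ a ρ t) (conf τ a ρ t (pos τ a ρ t)) := by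
  simp [pos, conf, traj, step]

lemma conf_succ_ne (τ : V → V → V) (a : V) (ρ : V → V) (t : ℕ) {y : V}
    (h : pos τ a ρ t ≠ y) : conf τ a ρ (t + 1) y = conf τ a ρ t y := by
  unfold pos at h
  simp [conf, traj, step, h.symm]

lemma traj_big {τ : V → V → V} {Z : Set V} {z a : V} (hz : z ∈ Z) (ha : a ∉ Z) (ρ : V → V)
    (t : ℕ) (h : ∀ s < t, pos τ a ρ s ∉ Z) :
    (bigStep τ Z z a)^[t + 1] (z, ρ) = (col Z z (pos τ a ρ t), conf τ a ρ t) := by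
  induction t with
  | zero => simp [bigStep, hz, pos, conf, traj, col, ha]
  | succ t ih =>
    rw [Function.iterate_succ_apply', ih (fun s hs => h s (by omega))]
    have h1 : pos τ a ρ t ∉ Z := h t (by omega)
    have h2 : col Z z (pos τ a ρ t) = pos τ a ρ t := by simp [col, h1]
    rw [h2]
    unfold bigStep
    rw [if_neg h1]
    rfl

/-- hitting time of the sink -/
noncomputable def hit (τ : V → V → V) (Z : Set V) (a : V) (ρ : V → V) : ℕ :=
  sInf {t | pos τ a ρ t ∈ Z}

lemma hits [Finite V] {G : SimpleGraph V} {τ : V → V → V} {Z : Set V} {z a : V} (hz : z ∈ Z)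
    (hτ : ValidMechanism G Z τ) (ha : a ∉ Z) {ρ : V → V} (hρ : IsOSF G Z ρ) :
    ∃ t, pos τ a ρ t ∈ Z := by
  by_contra! hcon
  obtain ⟨n, hn⟩ := big_periodic hτ ha ((osf_iff hz ha ρ).2 hρ)
  rw [traj_big hz ha ρ n (fun s _ => hcon s)] at hn
  have h2 : col Z z (pos τ a ρ n) = pos τ a ρ n := by simp [col, hcon n]
  have := congrArg Prod.fst hn
  simp only [h2] at this
  exact hcon n (this ▸ hz)

lemma hit_mem [Finite V] {G : SimpleGraph V} {τ : V → V → V} {Z : Set V} {z a : V} (hz : z ∈ Z)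
    (hτ : ValidMechanism G Z τ) (ha : a ∉ Z) {ρ : V → V} (hρ : IsOSF G Z ρ) :
    pos τ a ρ (hit τ Z a ρ) ∈ Z := Nat.sInf_mem (hits hz hτ ha hρ)

lemma not_mem_of_lt_hit {τ : V → V → V} {Z : Set V} {a : V} {ρ : V → V} {t : ℕ}
    (h : t < hit τ Z a ρ) : pos τ a ρ t ∉ Z := Nat.notMem_of_lt_sInf h

lemma alive_iff [Finite V] {G : SimpleGraph V} {τ : V → V → V} {Z : Set V} {z a : V} (hz : z ∈ Z)
    (hτ : ValidMechanism G Z τ) (ha : a ∉ Z) {ρ : V → V} (hρ : IsOSF G Z ρ) (t : ℕ) :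
    aliveAt τ Z a ρ t ↔ t < hit τ Z a ρ := by
  constructor
  · intro h
    by_contra! hc
    exact h _ hc (hit_mem hz hτ ha hρ)
  · intro h s hs
    exact not_mem_of_lt_hit (lt_of_le_of_lt hs h)

lemma conf_adj {G : SimpleGraph V} {τ : V → V → V} {Z : Set V} {z a : V} (hz : z ∈ Z)
    (hτ : ValidMechanism G Z τ) (ha : a ∉ Z) {ρ : V → V} (hρ : IsOSF G Z ρ) {t : ℕ}
    (ht : t ≤ hit τ Z a ρ) {y : V} (hy : y ∉ Z) : G.Adj y (conf τ a ρ t y) := by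
  have h := iter_maps hτ ha ((osf_iff hz ha ρ).2 hρ) (t + 1)
  rw [traj_big hz ha ρ t (fun s hs => not_mem_of_lt_hit (lt_of_lt_of_le hs ht))] at h
  exact h.2.1 y hy

/-- final configuration -/
noncomputable def sig (τ : V → V → V) (Z : Set V) (a : V) (ρ : V → V) : V → V :=
  conf τ a ρ (hit τ Z a ρ)

lemma big_hit [Finite V] {G : SimpleGraph V} {τ : V → V → V} {Z : Set V} {z a : V} (hz : z ∈ Z)
    (hτ : ValidMechanism G Z τ) (ha : a ∉ Z) {ρ : V → V} (hρ : IsOSF G Z ρ) :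
    (bigStep τ Z z a)^[hit τ Z a ρ + 1] (z, ρ) = (z, sig τ Z a ρ) := by
  rw [traj_big hz ha ρ _ (fun s hs => not_mem_of_lt_hit hs)]
  simp [col, hit_mem hz hτ ha hρ, sig]

lemma sig_osf [Finite V] {G : SimpleGraph V} {τ : V → V → V} {Z : Set V} {z a : V} (hz : z ∈ Z)
    (hτ : ValidMechanism G Z τ) (ha : a ∉ Z) {ρ : V → V} (hρ : IsOSF G Z ρ) :
    IsOSF G Z (sig τ Z a ρ) := by
  have h := iter_maps hτ ha ((osf_iff hz ha ρ).2 hρ) (hit τ Z a ρ + 1)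
  rw [big_hit hz hτ ha hρ] at h
  exact (osf_iff hz ha _).1 h

lemma sig_inj [Finite V] {G : SimpleGraph V} {τ : V → V → V} {Z : Set V} {z a : V} (hz : z ∈ Z)
    (hτ : ValidMechanism G Z τ) (ha : a ∉ Z) {ρ ρ' : V → V} (hρ : IsOSF G Z ρ)
    (hρ' : IsOSF G Z ρ') (h : sig τ Z a ρ = sig τ Z a ρ') : ρ = ρ' := by
  wlog hle : hit τ Z a ρ ≤ hit τ Z a ρ' generalizing ρ ρ'
  · exact (this hρ' hρ h.symm (by omega)).symm
  obtain ⟨k, hk⟩ := Nat.exists_eq_add_of_le hle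
  have h1 := big_hit hz hτ ha hρ
  have h2 := big_hit hz hτ ha hρ'
  rw [← h, ← h1, hk, show hit τ Z a ρ + k + 1 = (hit τ Z a ρ + 1) + k by ring,
    Function.iterate_add_apply] at h2
  have hu := (osf_iff hz ha ρ).2 hρ
  have hu' := (osf_iff hz ha ρ').2 hρ'
  have h3 := iter_inj hτ ha (iter_maps hτ ha hu' k) hu _ h2
  cases k with
  | zero => simpa using h3.symm
  | succ k =>
    exfalso
    rw [traj_big hz ha ρ' k (fun s hs => not_mem_of_lt_hit (by omega))] at h3
    have hn : pos τ a ρ' k ∉ Z := not_mem_of_lt_hit (by omega)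
    have h4 := congrArg Prod.fst h3
    simp only [col, hn, if_false] at h4
    exact hn (h4 ▸ hz)

open Classical in
/-- the forests -/
noncomputable def forests [Fintype V] (G : SimpleGraph V) (Z : Set V) : Finset (V → V) :=
  Finset.univ.filter (fun ρ : V → V => IsOSF G Z ρ)

lemma mem_forests [Fintype V] {G : SimpleGraph V} {Z : Set V} {ρ : V → V} :
    ρ ∈ forests G Z ↔ IsOSF G Z ρ := by simp [forests]

lemma sum_sig [Fintype V] {G : SimpleGraph V} {τ : V → V → V} {Z : Set V} {z a : V} (hz : z ∈ Z)
    (hτ : ValidMechanism G Z τ) (ha : a ∉ Z) (φ : (V → V) → ℝ) :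
    ∑ ρ ∈ forests G Z, φ (sig τ Z a ρ) = ∑ ρ ∈ forests G Z, φ ρ := by
  have hm : Set.MapsTo (sig τ Z a) (forests G Z) (forests G Z) := by
    intro ρ hρ
    exact mem_forests.2 (sig_osf hz hτ ha (mem_forests.1 hρ))
  have hi : Set.InjOn (sig τ Z a) (forests G Z) := by
    intro ρ hρ ρ' hρ' h
    exact sig_inj hz hτ ha (mem_forests.1 hρ) (mem_forests.1 hρ') h
  exact Finset.sum_nbij (sig τ Z a) hm hi
    (Finset.surjOn_of_injOn_of_card_le _ hm hi le_rfl) (fun _ _ => rfl)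

/-! ### Counting -/

/-- total over forests and alive times -/
noncomputable def tot [Fintype V] (G : SimpleGraph V) (τ : V → V → V) (Z : Set V) (a : V)
    (φ : (V → V) → ℕ → ℝ) : ℝ :=
  ∑ ρ ∈ forests G Z, ∑ t ∈ Finset.range (hit τ Z a ρ), φ ρ t

lemma tot_congr [Fintype V] {G : SimpleGraph V} {τ : V → V → V} {Z : Set V} {a : V}
    {φ ψ : (V → V) → ℕ → ℝ}
    (h : ∀ ρ, IsOSF G Z ρ → ∀ t < hit τ Z a ρ, φ ρ t = ψ ρ t) :
    tot G τ Z a φ = tot G τ Z a ψ := by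
  refine Finset.sum_congr rfl fun ρ hρ => Finset.sum_congr rfl fun t ht => ?_
  exact h ρ (mem_forests.1 hρ) t (Finset.mem_range.1 ht)

lemma tot_telescope [Fintype V] {G : SimpleGraph V} {τ : V → V → V} {Z : Set V} {z a : V}
    (hz : z ∈ Z) (hτ : ValidMechanism G Z τ) (ha : a ∉ Z) (φ : (V → V) → ℝ) :
    tot G τ Z a (fun ρ t => φ (conf τ a ρ (t + 1)) - φ (conf τ a ρ t)) = 0 := by
  unfold tot
  have hs : ∀ ρ, ∑ t ∈ Finset.range (hit τ Z a ρ),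
      (φ (conf τ a ρ (t + 1)) - φ (conf τ a ρ t)) =
      φ (conf τ a ρ (hit τ Z a ρ)) - φ (conf τ a ρ 0) :=
    fun ρ => Finset.sum_range_sub (fun t => φ (conf τ a ρ t)) _
  simp_rw [hs]
  rw [Finset.sum_sub_distrib]
  have := sum_sig hz hτ ha φ
  unfold sig at this
  rw [this]
  simp [conf, traj]

open Classical in
/-- visits -/
noncomputable def vis [Fintype V] (G : SimpleGraph V) (τ : V → V → V) (Z : Set V) (a x : V) : ℝ :=
  tot G τ Z a (fun ρ t => if pos τ a ρ t = x then 1 else 0)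

open Classical in
/-- traversals of `(y,v)` -/
noncomputable def trav [Fintype V] (G : SimpleGraph V) (τ : V → V → V) (Z : Set V) (a y v : V) :
    ℝ :=
  tot G τ Z a (fun ρ t => if pos τ a ρ t = y ∧ conf τ a ρ (t + 1) y = v then 1 else 0)

lemma trav_step [Fintype V] {G : SimpleGraph V} {τ : V → V → V} {Z : Set V} {z a : V}
    (hz : z ∈ Z) (hτ : ValidMechanism G Z τ) (ha : a ∉ Z) {y v : V} (hy : y ∉ Z)
    (hv : G.Adj y v) : trav G τ Z a y (τ y v) = trav G τ Z a y v := by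
  classical
  have h := tot_telescope hz hτ ha (G := G) (fun ρ => if ρ y = v then (1 : ℝ) else 0)
  have e : trav G τ Z a y v - trav G τ Z a y (τ y v) = 0 := by
    rw [← h]
    unfold trav tot
    rw [← Finset.sum_sub_distrib]
    refine Finset.sum_congr rfl fun ρ hρ => ?_
    rw [← Finset.sum_sub_distrib]
    refine Finset.sum_congr rfl fun t ht => ?_
    have ht' := Finset.mem_range.1 ht
    have hadj := conf_adj hz hτ ha (mem_forests.1 hρ) ht'.le hy
    by_cases hp : pos τ a ρ t = y
    · have hs := conf_succ_self τ a ρ t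
      rw [hp] at hs
      have hiff : τ y (conf τ a ρ t y) = τ y v ↔ conf τ a ρ t y = v :=
        ⟨fun hh => mech_inj hτ hy hadj hv hh, fun hh => by rw [hh]⟩
      simp [hp, hs, hiff]
    · simp [hp, conf_succ_ne τ a ρ t hp]
  linarith

lemma trav_eq [Fintype V] {G : SimpleGraph V} {τ : V → V → V} {Z : Set V} {z a : V}
    (hz : z ∈ Z) (hτ : ValidMechanism G Z τ) (ha : a ∉ Z) {y v w : V} (hy : y ∉ Z)
    (hv : G.Adj y v) (hw : G.Adj y w) : trav G τ Z a y w = trav G τ Z a y v := by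
  obtain ⟨i, rfl⟩ := (hτ y hy).2 v hv w hw
  have : ∀ j, G.Adj y ((τ y)^[j] v) ∧ trav G τ Z a y ((τ y)^[j] v) = trav G τ Z a y v := by
    intro j
    induction j with
    | zero => exact ⟨hv, rfl⟩
    | succ j ih =>
      rw [Function.iterate_succ_apply']
      exact ⟨(hτ y hy).1 _ ih.1, by rw [trav_step hz hτ ha hy ih.1, ih.2]⟩
  exact (this i).2

lemma vis_eq_deg [Fintype V] {G : SimpleGraph V} [G.LocallyFinite] {τ : V → V → V} {Z : Set V}
    {z a : V} (hz : z ∈ Z) (hτ : ValidMechanism G Z τ) (ha : a ∉ Z) {y v : V} (hy : y ∉ Z)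
    (hv : G.Adj y v) : vis G τ Z a y = G.degree y * trav G τ Z a y v := by
  classical
  have h1 : ∑ w ∈ G.neighborFinset y, trav G τ Z a y w = G.degree y * trav G τ Z a y v := by
    rw [Finset.sum_congr rfl (fun w hw => trav_eq hz hτ ha hy hv
      ((G.mem_neighborFinset _ _).1 hw))]
    simp
  rw [← h1]
  unfold vis trav tot
  rw [Finset.sum_comm]
  refine Finset.sum_congr rfl fun ρ hρ => ?_
  rw [Finset.sum_comm]
  refine Finset.sum_congr rfl fun t ht => ?_
  have ht' := Finset.mem_range.1 ht
  have hadj := conf_adj hz hτ ha (mem_forests.1 hρ) (t := t + 1) ht' hy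
  by_cases hp : pos τ a ρ t = y
  · simp [hp, hadj]
  · simp [hp]

lemma vis_flow [Fintype V] {G : SimpleGraph V} [G.LocallyFinite] {τ : V → V → V} {Z : Set V}
    {z a : V} (hz : z ∈ Z) (hτ : ValidMechanism G Z τ) (ha : a ∉ Z) {x : V} (hx : x ∉ Z) :
    vis G τ Z a x = Set.indicator {a} (fun _ => ((forests G Z).card : ℝ)) x +
      ∑ y, Set.indicator {y | G.Adj y x ∧ y ∉ Z} (fun y => vis G τ Z a y / (G.degree y : ℝ)) y := by
  classical
  have h1 : ∀ y, Set.indicator {y | G.Adj y x ∧ y ∉ Z}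
      (fun y => vis G τ Z a y / (G.degree y : ℝ)) y = trav G τ Z a y x := by
    intro y
    by_cases hy : G.Adj y x ∧ y ∉ Z
    · rw [Set.indicator_of_mem (by exact hy), vis_eq_deg hz hτ ha hy.2 hy.1]
      have : (G.degree y : ℝ) ≠ 0 := by
        have : 0 < G.degree y := (G.degree_pos_iff_exists_adj y).2 ⟨x, hy.1⟩
        positivity
      field_simp
    · rw [Set.indicator_of_notMem (by exact hy)]
      symm
      refine Finset.sum_eq_zero fun ρ hρ => Finset.sum_eq_zero fun t ht => ?_
      have ht' := Finset.mem_range.1 ht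
      refine if_neg ?_
      rintro ⟨h2, h3⟩
      have hyZ : y ∉ Z := h2 ▸ not_mem_of_lt_hit ht'
      exact hy ⟨h3 ▸ conf_adj hz hτ ha (mem_forests.1 hρ) (t := t + 1) ht' hyZ, hyZ⟩
  simp_rw [h1]
  have h2 : Set.indicator {a} (fun _ => ((forests G Z).card : ℝ)) x =
      ∑ ρ ∈ forests G Z, if a = x then (1 : ℝ) else 0 := by
    by_cases hax : a = x
    · simp [hax]
    · simp [hax, Ne.symm hax]
  rw [h2]
  unfold vis trav tot
  rw [Finset.sum_comm (s := Finset.univ), ← Finset.sum_add_distrib]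
  refine Finset.sum_congr rfl fun ρ hρ => ?_
  rw [Finset.sum_comm]
  have h3 : ∀ t, ∑ y, (if pos τ a ρ t = y ∧ conf τ a ρ (t + 1) y = x then (1 : ℝ) else 0) =
      if pos τ a ρ (t + 1) = x then 1 else 0 := by
    intro t
    rw [Finset.sum_eq_single (pos τ a ρ t), pos_succ]
    · simp
    · intro b _ hb
      simp [Ne.symm hb]
    · simp
  simp_rw [h3]
  have h4 := Finset.sum_range_succ (fun t => if pos τ a ρ t = x then (1 : ℝ) else 0)
    (hit τ Z a ρ)
  rw [Finset.sum_range_succ'] at h4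
  have h5 : pos τ a ρ (hit τ Z a ρ) ≠ x :=
    fun h => hx (h ▸ hit_mem hz hτ ha (mem_forests.1 hρ))
  have h6 : pos τ a ρ 0 = a := rfl
  rw [if_neg h5, h6] at h4
  linarith

lemma odo_eq [Fintype V] {G : SimpleGraph V} {τ : V → V → V} {Z : Set V}
    {z a : V} (hz : z ∈ Z) (hτ : ValidMechanism G Z τ) (ha : a ∉ Z) (x : V) :
    ∑ ρ ∈ forests G Z, (odometer τ Z a ρ x : ℝ≥0∞) = ENNReal.ofReal (vis G τ Z a x) := by
  classical
  unfold vis tot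
  rw [ENNReal.ofReal_sum_of_nonneg]
  · refine Finset.sum_congr rfl fun ρ hρ => ?_
    have : {t : ℕ | aliveAt τ Z a ρ t ∧ pos τ a ρ t = x} =
        ((Finset.range (hit τ Z a ρ)).filter (fun t => pos τ a ρ t = x) : Finset ℕ) := by
      ext t
      simp [alive_iff hz hτ ha (mem_forests.1 hρ)]
    unfold odometer
    rw [this, Set.encard_coe_eq_coe_finsetCard]
    simp
  · intro ρ hρ
    exact Finset.sum_nonneg fun t _ => by beta_reduce; split_ifs <;> norm_num

lemma vis_nonneg [Fintype V] {G : SimpleGraph V} {τ : V → V → V} {Z : Set V}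
    {a : V} (x : V) : 0 ≤ vis G τ Z a x :=
  Finset.sum_nonneg fun _ _ => Finset.sum_nonneg fun t _ => by beta_reduce; split_ifs <;> norm_num

lemma forests_pos [Fintype V] {G : SimpleGraph V} (hconn : G.Connected) {Z : Set V} {z : V}
    (hz : z ∈ Z) : 0 < (forests G Z).card := by
  classical
  rw [Finset.card_pos]
  have h1 : ∀ x, x ∉ Z → ∃ y, G.Adj x y ∧ G.dist y z < G.dist x z := by
    intro x hx
    obtain ⟨p, hp⟩ := (hconn.preconnected x z).exists_walk_length_eq_dist
    cases p with
    | nil => exact absurd hz hx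
    | cons h q =>
      refine ⟨_, h, ?_⟩
      have := SimpleGraph.dist_le q
      rw [SimpleGraph.Walk.length_cons] at hp
      omega
  choose f hf using h1
  let ρ : V → V := fun x => if h : x ∈ Z then x else f x h
  refine ⟨ρ, mem_forests.2 ⟨?_, ?_, ?_⟩⟩
  · intro x hx; simpa [ρ, hx] using (hf x hx).1
  · intro x hx; simp [ρ, hx]
  · have : ∀ n x, G.dist x z < n → ∃ m : ℕ, ρ^[m] x ∈ Z := by
      intro n
      induction n with
      | zero => intro x hx; omega
      | succ n ih =>
        intro x hx
        by_cases hxZ : x ∈ Z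
        · exact ⟨0, hxZ⟩
        · have he : ρ x = f x hxZ := by simp [ρ, hxZ]
          have := (hf x hxZ).2
          obtain ⟨m, hm⟩ := ih (ρ x) (by rw [he]; omega)
          exact ⟨m + 1, hm⟩
    exact fun x => this _ x (Nat.lt_succ_self _)

/-! ### Uniqueness for the Green equation -/

lemma harmonic_zero [Fintype V] {G : SimpleGraph V} [G.LocallyFinite] (hconn : G.Connected)
    {Z : Set V} {z : V} (hz : z ∈ Z) (r : V → ℝ) (hr : ∀ x ∉ Z, 0 ≤ r x)
    (h : ∀ x ∉ Z, r x =
      ∑ y, Set.indicator {y | G.Adj y x ∧ y ∉ Z} (fun y => r y / (G.degree y : ℝ)) y) :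
    ∀ x ∉ Z, r x = 0 := by
  classical
  -- boundary step
  have hdeg : ∀ {y w}, G.Adj y w → (0 : ℝ) < G.degree y := by
    intro y w hw
    exact_mod_cast (G.degree_pos_iff_exists_adj y).2 ⟨w, hw⟩
  have hnn : ∀ x y, 0 ≤ Set.indicator {y | G.Adj y x ∧ y ∉ Z}
      (fun y => r y / (G.degree y : ℝ)) y := by
    intro x y
    refine Set.indicator_apply_nonneg fun hy => ?_
    exact div_nonneg (hr y hy.2) (Nat.cast_nonneg _)
  have hle : ∀ y, y ∉ Z → ∑ x, Set.indicator {y | G.Adj y x ∧ y ∉ Z}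
      (fun y => r y / (G.degree y : ℝ)) y ≤ r y := by
    intro y hy
    have e : ∀ x, Set.indicator {y | G.Adj y x ∧ y ∉ Z}
      (fun y => r y / (G.degree y : ℝ)) y =
        if x ∈ G.neighborFinset y then r y / (G.degree y : ℝ) else 0 := by
      intro x
      simp [Set.indicator_apply, hy]
    simp_rw [e]
    rw [Finset.sum_ite_mem, Finset.univ_inter, Finset.sum_const, nsmul_eq_mul,
      SimpleGraph.card_neighborFinset_eq_degree]
    by_cases hd : (G.degree y : ℝ) = 0
    · simpa [hd] using hr y hy
    · rw [mul_div_cancel₀ _ hd]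
  have hbd : ∀ y ∉ Z, ∀ u ∈ Z, G.Adj y u → r y = 0 := by
    have hsum : ∑ x with x ∉ Z, r x ≤ ∑ y with y ∉ Z,
        (r y - ∑ x with x ∈ Z, Set.indicator {y | G.Adj y x ∧ y ∉ Z}
          (fun y => r y / (G.degree y : ℝ)) y) := by
      calc ∑ x with x ∉ Z, r x = ∑ x with x ∉ Z, ∑ y, Set.indicator {y | G.Adj y x ∧ y ∉ Z}
            (fun y => r y / (G.degree y : ℝ)) y :=
            Finset.sum_congr rfl fun x hx => h x (by simpa using hx)
        _ = ∑ y, ∑ x with x ∉ Z, Set.indicator {y | G.Adj y x ∧ y ∉ Z}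
            (fun y => r y / (G.degree y : ℝ)) y := Finset.sum_comm
        _ = ∑ y with y ∉ Z, ∑ x with x ∉ Z, Set.indicator {y | G.Adj y x ∧ y ∉ Z}
            (fun y => r y / (G.degree y : ℝ)) y := by
            rw [Finset.sum_filter]
            refine Finset.sum_congr rfl fun y _ => ?_
            split_ifs with hy
            · refine Finset.sum_eq_zero fun x _ => ?_
              have hn : y ∉ {y | G.Adj y x ∧ y ∉ Z} := fun hh => hh.2 hy
              rw [Set.indicator_of_notMem hn]
            · rfl
        _ ≤ _ := by
            refine Finset.sum_le_sum fun y hy => ?_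
            have h1 := hle y (by simpa using hy)
            rw [← Finset.sum_filter_add_sum_filter_not Finset.univ (fun x => x ∈ Z)] at h1
            linarith
    rw [Finset.sum_sub_distrib] at hsum
    have hz0 : ∑ y with y ∉ Z, ∑ x with x ∈ Z, Set.indicator {y | G.Adj y x ∧ y ∉ Z}
          (fun y => r y / (G.degree y : ℝ)) y = 0 :=
      le_antisymm (by linarith) (Finset.sum_nonneg fun y _ => Finset.sum_nonneg fun x _ => hnn x y)
    intro y hy u hu hyu
    rw [Finset.sum_eq_zero_iff_of_nonneg
      (fun y _ => Finset.sum_nonneg fun x _ => hnn x y)] at hz0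
    have h2 := hz0 y (by simpa using hy)
    rw [Finset.sum_eq_zero_iff_of_nonneg (fun x _ => hnn x y)] at h2
    have h3 := h2 u (by simpa using hu)
    rw [Set.indicator_of_mem (by exact ⟨hyu, hy⟩)] at h3
    have := hdeg hyu
    rcases div_eq_zero_iff.1 h3 with h4 | h4
    · exact h4
    · linarith
  have hprop : ∀ y ∉ Z, ∀ u ∉ Z, G.Adj y u → r u = 0 → r y = 0 := by
    intro y hy u hu hyu hru
    have h1 := h u hu
    rw [hru, eq_comm, Finset.sum_eq_zero_iff_of_nonneg (fun y _ => hnn u y)] at h1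
    have h3 := h1 y (Finset.mem_univ _)
    rw [Set.indicator_of_mem (by exact ⟨hyu, hy⟩)] at h3
    have := hdeg hyu
    rcases div_eq_zero_iff.1 h3 with h4 | h4
    · exact h4
    · linarith
  have hwalk : ∀ {x w : V} (p : G.Walk x w), w ∈ Z → x ∉ Z → r x = 0 := by
    intro x w p
    induction p with
    | nil => intro h1 h2; exact absurd h1 h2
    | @cons u v w hadj q ih =>
      intro h1 h2
      by_cases hv : v ∈ Z
      · exact hbd u h2 v hv hadj
      · exact hprop u h2 v hv hadj (ih h1 hv)
  intro x hx
  obtain ⟨p⟩ := hconn.preconnected x z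
  exact hwalk p hz hx

lemma green_eq [Fintype V] (G : SimpleGraph V) [G.LocallyFinite] (Z : Set V) (a : V) (x : V) :
    ∑' t, srw G Z a t x = Set.indicator {a} 1 x +
      ∑ y, Set.indicator {y | G.Adj y x ∧ y ∉ Z}
        (fun y => (∑' t, srw G Z a t y) / (G.degree y : ℝ≥0∞)) y := by
  rw [tsum_eq_zero_add' ENNReal.summable]
  congr 1
  simp only [srw, tsum_fintype]
  rw [Summable.tsum_finsetSum (fun _ _ => ENNReal.summable)]
  refine Finset.sum_congr rfl fun y _ => ?_
  by_cases hy : y ∈ {y | G.Adj y x ∧ y ∉ Z}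
  · simp only [Set.indicator_of_mem hy, div_eq_mul_inv, ENNReal.tsum_mul_right]
  · simp only [Set.indicator_of_notMem hy, tsum_zero]

lemma green_le [Fintype V] {G : SimpleGraph V} [G.LocallyFinite] {Z : Set V} {a : V}
    (g : V → ℝ≥0∞)
    (hg : ∀ x ∉ Z, g x = Set.indicator {a} 1 x +
      ∑ y, Set.indicator {y | G.Adj y x ∧ y ∉ Z} (fun y => g y / (G.degree y : ℝ≥0∞)) y) :
    ∀ x ∉ Z, ∑' t, srw G Z a t x ≤ g x := by
  have key : ∀ n, ∀ x ∉ Z, ∑ t ∈ Finset.range n, srw G Z a t x ≤ g x := by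
    intro n
    induction n with
    | zero => intro x _; simp
    | succ n ih =>
      intro x hx
      rw [Finset.sum_range_succ', hg x hx, add_comm]
      refine add_le_add le_rfl ?_
      simp only [srw, tsum_fintype]
      rw [Finset.sum_comm]
      refine Finset.sum_le_sum fun y _ => ?_
      by_cases hy : y ∈ {y | G.Adj y x ∧ y ∉ Z}
      · simp only [Set.indicator_of_mem hy, div_eq_mul_inv]
        rw [← Finset.sum_mul]
        gcongr
        exact ih y hy.2
      · simp only [Set.indicator_of_notMem hy, Finset.sum_const_zero, le_refl]
  intro x hx
  rw [ENNReal.tsum_eq_iSup_nat]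
  exact iSup_le fun n => key n x hx

/-- real form of the Green equation -/
lemma toReal_eqn [Fintype V] {G : SimpleGraph V} [G.LocallyFinite] {Z : Set V} {a : V}
    {g : V → ℝ≥0∞} (hfin : ∀ x ∉ Z, g x ≠ ⊤) {x : V}
    (hg : g x = Set.indicator {a} 1 x +
      ∑ y, Set.indicator {y | G.Adj y x ∧ y ∉ Z} (fun y => g y / (G.degree y : ℝ≥0∞)) y) :
    (g x).toReal = Set.indicator {a} 1 x +
      ∑ y, Set.indicator {y | G.Adj y x ∧ y ∉ Z}
        (fun y => (g y).toReal / (G.degree y : ℝ)) y := by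
  have h1 : ∀ y, Set.indicator {y | G.Adj y x ∧ y ∉ Z}
      (fun y => g y / (G.degree y : ℝ≥0∞)) y ≠ ⊤ := by
    intro y
    by_cases hy : y ∈ {y | G.Adj y x ∧ y ∉ Z}
    · rw [Set.indicator_of_mem hy]
      refine ENNReal.div_ne_top (hfin y hy.2) ?_
      exact_mod_cast ((G.degree_pos_iff_exists_adj y).2 ⟨x, hy.1⟩).ne'
    · rw [Set.indicator_of_notMem hy]; simp
  have h2 : Set.indicator {a} (1 : V → ℝ≥0∞) x ≠ ⊤ := by
    by_cases hx : x ∈ ({a} : Set V)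
    · rw [Set.indicator_of_mem hx]; simp
    · rw [Set.indicator_of_notMem hx]; simp
  rw [hg, ENNReal.toReal_add h2 (ENNReal.sum_ne_top.2 fun y _ => h1 y),
    ENNReal.toReal_sum fun y _ => h1 y]
  congr 1
  · by_cases hx : x ∈ ({a} : Set V)
    · rw [Set.indicator_of_mem hx, Set.indicator_of_mem hx]; simp
    · rw [Set.indicator_of_notMem hx, Set.indicator_of_notMem hx]; simp
  · refine Finset.sum_congr rfl fun y _ => ?_
    by_cases hy : y ∈ {y | G.Adj y x ∧ y ∉ Z}
    · rw [Set.indicator_of_mem hy, Set.indicator_of_mem hy, ENNReal.toReal_div]; simp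
    · rw [Set.indicator_of_notMem hy, Set.indicator_of_notMem hy]; simp

lemma green_unique [Fintype V] {G : SimpleGraph V} [G.LocallyFinite] (hconn : G.Connected)
    {Z : Set V} {z : V} (hz : z ∈ Z) {a : V} (g : V → ℝ≥0∞) (hfin : ∀ x ∉ Z, g x ≠ ⊤)
    (hg : ∀ x ∉ Z, g x = Set.indicator {a} 1 x +
      ∑ y, Set.indicator {y | G.Adj y x ∧ y ∉ Z} (fun y => g y / (G.degree y : ℝ≥0∞)) y) :
    ∀ x ∉ Z, g x = ∑' t, srw G Z a t x := by
  have hle := green_le g hg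
  have hfin' : ∀ x ∉ Z, ∑' t, srw G Z a t x ≠ ⊤ := fun x hx =>
    ne_top_of_le_ne_top (hfin x hx) (hle x hx)
  have h0 := harmonic_zero hconn hz
    (fun x => (g x).toReal - (∑' t, srw G Z a t x).toReal)
    (fun x hx => sub_nonneg.2 (ENNReal.toReal_mono (hfin x hx) (hle x hx))) (by
      intro x hx
      beta_reduce
      rw [toReal_eqn hfin (hg x hx), toReal_eqn hfin' (green_eq G Z a x), add_sub_add_left_eq_sub,
        ← Finset.sum_sub_distrib]
      refine Finset.sum_congr rfl fun y _ => ?_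
      by_cases hy : y ∈ {y | G.Adj y x ∧ y ∉ Z}
      · simp only [Set.indicator_of_mem hy, sub_div]
      · simp only [Set.indicator_of_notMem hy, sub_zero])
  intro x hx
  have := h0 x hx
  exact (ENNReal.toReal_eq_toReal_iff' (hfin x hx) (hfin' x hx)).1 (by linarith)

lemma main_off [Fintype V] {G : SimpleGraph V} [G.LocallyFinite] (hconn : G.Connected)
    {Z : Set V} {z : V} (hz : z ∈ Z) {τ : V → V → V} (hτ : ValidMechanism G Z τ) {a : V}
    (ha : a ∉ Z) {x : V} (hx : x ∉ Z) :
    (∑ ρ ∈ forests G Z, (odometer τ Z a ρ x : ℝ≥0∞)) / ((forests G Z).card : ℝ≥0∞) =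
      ∑' t, srw G Z a t x := by
  have hN := forests_pos hconn hz
  have hN' : (0 : ℝ) < (forests G Z).card := by exact_mod_cast hN
  have e : (∑ ρ ∈ forests G Z, (odometer τ Z a ρ x : ℝ≥0∞)) / ((forests G Z).card : ℝ≥0∞) =
      ENNReal.ofReal (vis G τ Z a x / (forests G Z).card) := by
    rw [odo_eq hz hτ ha, ENNReal.ofReal_div_of_pos hN', ENNReal.ofReal_natCast]
  rw [e]
  refine green_unique hconn hz (fun x => ENNReal.ofReal (vis G τ Z a x / (forests G Z).card))
    (fun _ _ => ENNReal.ofReal_ne_top) ?_ x hx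
  intro x hx
  have hnn : ∀ y, 0 ≤ Set.indicator {y | G.Adj y x ∧ y ∉ Z}
      (fun y => vis G τ Z a y / (G.degree y : ℝ)) y := fun y =>
    Set.indicator_apply_nonneg fun hy => div_nonneg (vis_nonneg y) (Nat.cast_nonneg _)
  beta_reduce
  rw [vis_flow hz hτ ha hx, add_div, ENNReal.ofReal_add, Finset.sum_div,
    ENNReal.ofReal_sum_of_nonneg (fun y _ => div_nonneg (hnn y) hN'.le)]
  · congr 1
    · by_cases hxa : x ∈ ({a} : Set V)
      · rw [Set.indicator_of_mem hxa, Set.indicator_of_mem hxa, div_self hN'.ne']; simp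
      · rw [Set.indicator_of_notMem hxa, Set.indicator_of_notMem hxa]; simp
    · refine Finset.sum_congr rfl fun y _ => ?_
      by_cases hy : y ∈ {y | G.Adj y x ∧ y ∉ Z}
      · have hd : (0 : ℝ) < G.degree y := by
          exact_mod_cast (G.degree_pos_iff_exists_adj y).2 ⟨x, hy.1⟩
        rw [Set.indicator_of_mem hy, Set.indicator_of_mem hy, div_right_comm,
          ENNReal.ofReal_div_of_pos hd, ENNReal.ofReal_natCast]
      · rw [Set.indicator_of_notMem hy, Set.indicator_of_notMem hy]; simp
  · exact div_nonneg (Set.indicator_apply_nonneg fun _ => hN'.le) hN'.le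
  · exact div_nonneg (Finset.sum_nonneg fun y _ => hnn y) hN'.le

lemma odo_zero {τ : V → V → V} {Z : Set V} {a x : V} (h : a ∈ Z ∨ x ∈ Z) (ρ : V → V) :
    odometer τ Z a ρ x = 0 := by
  unfold odometer
  rw [Set.encard_eq_zero, Set.eq_empty_iff_forall_notMem]
  rintro t ⟨h1, h2⟩
  rcases h with h | h
  · exact h1 0 (Nat.zero_le _) h
  · exact h1 t le_rfl (h2 ▸ h)

lemma srw_zero {G : SimpleGraph V} [G.LocallyFinite] {Z : Set V} {a : V} (ha : a ∈ Z) (t : ℕ) :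
    ∀ x ∉ Z, srw G Z a t x = 0 := by
  induction t with
  | zero =>
    intro x hx
    have hxa : x ∉ ({a} : Set V) := fun h => hx ((show x = a from h) ▸ ha)
    simp only [srw]
    rw [Set.indicator_of_notMem hxa]
  | succ t ih =>
    intro x hx
    simp only [srw, ENNReal.tsum_eq_zero]
    intro y
    by_cases hy : y ∈ {y | G.Adj y x ∧ y ∉ Z}
    · rw [Set.indicator_of_mem hy, ih y hy.2]; simp
    · rw [Set.indicator_of_notMem hy]

end Aux

open Classical in
/-- on a finite simple connected graph with nonempty sink `Z`, if the initial
rotor configuration is uniform on `Z`-oriented spanning forests, then the expected number of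
visits to any vertex `x` by the rotor walk started at `a` equals the Green function `G(a,x)`. -/
theorem expected_odometer_eq_green_finite
    {V : Type*} [DecidableEq V] [Fintype V]
    (G : SimpleGraph V) [G.LocallyFinite] (hconn : G.Connected)
    (Z : Set V) (hZ : Z.Nonempty)
    (τ : V → V → V) (hτ : ValidMechanism G Z τ) (a : V) (x : V) :
    (∑ ρ ∈ Finset.univ.filter (fun ρ : V → V => IsOSF G Z ρ),
        (odometer τ Z a ρ x : ℝ≥0∞)) /
      ((Finset.univ.filter (fun ρ : V → V => IsOSF G Z ρ)).card : ℝ≥0∞) =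
    green G Z a x := by
  obtain ⟨z, hz⟩ := hZ
  by_cases hx : x ∈ Z
  · have hg : green G Z a x = 0 := Set.indicator_of_notMem (by simpa using hx) _
    rw [hg]
    simp [odo_zero (Or.inr hx)]
  have hg : green G Z a x = ∑' t : ℕ, srw G Z a t x := Set.indicator_of_mem (by simpa using hx) _
  rw [hg]
  by_cases ha : a ∈ Z
  · simp [odo_zero (Or.inl ha), srw_zero ha _ x hx]
  have := main_off hconn hz hτ ha hx
  unfold forests at this
  convert this
end RotorWalk
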